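/- For the potential φ(x) = 2^{d_1(x)}: the Hausdorff dimension of the set {x ∈ (0,1] : lim_{m→∞} (1/m) ∑_{j=1}^{m} 2^{d_j(x)} = 2} is 0, and the Hausdorff dimension of the set {x ∈ (0,1] : lim_{m→∞} (1/m) ∑_{j=1}^{m} 2^{d_j(x)} = +∞} (i.e. the Birkhoff sums (1/m) ∑_{j=1}^{m} 2^{d_j(x)} tend to infinity) is 1. -/

import Mathlib

open MeasureTheory Filter Real Set

/-- The power-2-decaying Gauss-like expansion map: `T x = 2^n x - 1` for
`x ∈ (2^{-n}, 2^{-(n-1)}]`, where the branch index is `n = ⌊-log₂ x⌋ + 1`. -/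
noncomputable def p2gleT (x : ℝ) : ℝ := 2 ^ (⌊-Real.logb 2 x⌋ + 1) * x - 1

/-- The `(j+1)`-th P2GLE digit: `d_{j+1}(x) = d₁(T^j x)` with `d₁(x) = ⌈-log₂ x⌉`. -/
noncomputable def p2gleD (j : ℕ) (x : ℝ) : ℤ := ⌈-Real.logb 2 (p2gleT^[j] x)⌉

/-- The level set `E(ξ)` of points whose Khintchine exponent equals `ξ`. -/
noncomputable def khinchinLevelSet (ξ : ℝ) : Set ℝ :=
  {x ∈ Ioc (0:ℝ) 1 |
    Tendsto (fun n : ℕ => (∑ j ∈ Finset.range n, (p2gleD j x : ℝ)) / n) atTop (nhds ξ)}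

/-- The level set of points whose Birkhoff average of `2^{d₁}` equals `ξ`. -/
noncomputable def expDigitLevelSet (ξ : ℝ) : Set ℝ :=
  {x ∈ Ioc (0:ℝ) 1 |
    Tendsto (fun m : ℕ => (∑ j ∈ Finset.range m, (2:ℝ) ^ (p2gleD j x)) / m)
      atTop (nhds ξ)}

/-- The set of points whose Birkhoff averages of `2^{d₁}` tend to infinity. -/
noncomputable def expDigitInfSet : Set ℝ :=
  {x ∈ Ioc (0:ℝ) 1 |
    Tendsto (fun m : ℕ => (∑ j ∈ Finset.range m, (2:ℝ) ^ (p2gleD j x)) / m)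
      atTop atTop}

/-- The index of the branch of `p2gleT` that is applied at `x`. -/
noncomputable def p2gleBranch (x : ℝ) : ℤ := ⌊-Real.logb 2 x⌋ + 1

lemma p2gleBranch_eq_iff {x : ℝ} (hx : 0 < x) (k : ℤ) :
    p2gleBranch x = k ↔ 1 < 2 ^ k * x ∧ 2 ^ k * x ≤ 2 := by
  have h2 : (0:ℝ) < 2 ^ k := by positivity
  have key : Real.logb 2 (2 ^ k * x) = k + Real.logb 2 x := by
    rw [Real.logb_mul h2.ne' hx.ne', ← Real.rpow_intCast, Real.logb_rpow] <;> norm_num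
  have hl : 1 < 2 ^ k * x ↔ 0 < k + Real.logb 2 x := by
    rw [← key, Real.logb_pos_iff (by norm_num) (by positivity)]
  have hu : 2 ^ k * x ≤ 2 ↔ k + Real.logb 2 x ≤ 1 := by
    rw [← key, Real.logb_le_iff_le_rpow (by norm_num) (by positivity), Real.rpow_one]
  rw [hl, hu, p2gleBranch, ← eq_sub_iff_add_eq, Int.floor_eq_iff]
  push_cast
  constructor <;> rintro ⟨h₁, h₂⟩ <;> constructor <;> linarith

lemma p2gleT_eq (x : ℝ) : p2gleT x = 2 ^ p2gleBranch x * x - 1 := rfl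

lemma p2gleT_mem {x : ℝ} (hx : 0 < x) : p2gleT x ∈ Ioc (0:ℝ) 1 := by
  obtain ⟨h₁, h₂⟩ := (p2gleBranch_eq_iff hx _).1 rfl
  rw [p2gleT_eq]
  constructor <;> linarith

lemma p2gleT_iterate_mem {x : ℝ} (hx : x ∈ Ioc (0:ℝ) 1) (j : ℕ) :
    p2gleT^[j] x ∈ Ioc (0:ℝ) 1 :=
  MapsTo.iterate (fun _ hy => p2gleT_mem hy.1) j hx

lemma one_le_p2gleBranch {x : ℝ} (hx : x ∈ Ioc (0:ℝ) 1) : 1 ≤ p2gleBranch x := by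
  have : 0 ≤ ⌊-Real.logb 2 x⌋ := by
    rw [Int.floor_nonneg, neg_nonneg]
    exact Real.logb_nonpos (by norm_num) hx.1.le hx.2
  unfold p2gleBranch
  omega

lemma ceil_neg_logb_eq_p2gleBranch {x : ℝ} (hx : 0 < x) (h : p2gleT x ≠ 1) :
    ⌈-Real.logb 2 x⌉ = p2gleBranch x := by
  refine (Int.ceil_eq_floor_add_one_iff_notMem _).2 ?_
  rintro ⟨n, hn⟩
  apply h
  have hb : p2gleBranch x = n + 1 := by rw [p2gleBranch, ← hn, Int.floor_intCast]
  have hxn : x = 2 ^ (-n) := by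
    rw [← Real.rpow_intCast, Int.cast_neg, hn, neg_neg,
      Real.rpow_logb (by norm_num) (by norm_num) hx]
  rw [p2gleT_eq, hb, hxn, ← zpow_add₀ (by norm_num : (2:ℝ) ≠ 0)]
  norm_num

/-- The points whose orbit hits `1`, the fixed point of the last branch. -/
def p2gleExceptional : Set ℝ := {x | ∃ j, p2gleT^[j] x = 1}

lemma countable_preimage_p2gleT {s : Set ℝ} (hs : s.Countable) : (p2gleT ⁻¹' s).Countable := by
  refine (countable_iUnion fun k : ℤ => hs.image fun y : ℝ => (y + 1) / 2 ^ k).mono ?_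
  intro x hx
  refine mem_iUnion.2 ⟨p2gleBranch x, p2gleT x, hx, ?_⟩
  have h2 : (2:ℝ) ^ p2gleBranch x ≠ 0 := by positivity
  simp only [p2gleT_eq, sub_add_cancel]
  field_simp

lemma countable_p2gleExceptional : p2gleExceptional.Countable := by
  have h (j : ℕ) : (p2gleT^[j] ⁻¹' {1}).Countable := by
    induction j with
    | zero => simp
    | succ j ih =>
      rw [Function.iterate_succ, preimage_comp]
      exact countable_preimage_p2gleT ih
  refine (countable_iUnion h).mono ?_
  rintro x ⟨j, hj⟩
  exact mem_iUnion.2 ⟨j, hj⟩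

lemma p2gleD_eq_p2gleBranch {x : ℝ} (hx : x ∈ Ioc (0:ℝ) 1) (hx' : x ∉ p2gleExceptional) (j : ℕ) :
    p2gleD j x = p2gleBranch (p2gleT^[j] x) := by
  refine ceil_neg_logb_eq_p2gleBranch (p2gleT_iterate_mem hx j).1 fun h => hx' ⟨j + 1, ?_⟩
  rwa [Function.iterate_succ_apply']

lemma abs_sub_le_of_p2gleBranch_eq {m : ℕ} {x y : ℝ} (hx : x ∈ Ioc (0:ℝ) 1)
    (hy : y ∈ Ioc (0:ℝ) 1)
    (h : ∀ i < m, p2gleBranch (p2gleT^[i] x) = p2gleBranch (p2gleT^[i] y)) :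
    |x - y| ≤ (1 / 2) ^ m := by
  induction m generalizing x y with
  | zero =>
    rw [pow_zero, abs_le]
    constructor <;> linarith [hx.1, hx.2, hy.1, hy.2]
  | succ m ih =>
    have hT := ih (p2gleT_mem hx.1) (p2gleT_mem hy.1) fun i hi => by
      simpa only [Function.iterate_succ_apply] using h (i + 1) (by omega)
    have h0 : p2gleBranch x = p2gleBranch y := h 0 (by omega)
    have h2 : (2:ℝ) ≤ 2 ^ p2gleBranch y := by
      simpa using zpow_le_zpow_right₀ (by norm_num : (1:ℝ) ≤ 2) (one_le_p2gleBranch hy)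
    have hsub : p2gleT x - p2gleT y = 2 ^ p2gleBranch y * (x - y) := by
      rw [p2gleT_eq, p2gleT_eq, h0]; ring
    rw [hsub, abs_mul, abs_of_pos (by positivity)] at hT
    rw [pow_succ]
    nlinarith [abs_nonneg (x - y)]

/-- The points for which the excess `d - 1` of the first `m` branch indices over their minimal value
is on average at most `1 / L`, for all `m ≥ N`. -/
def p2gleSparse (L N : ℕ) : Set ℝ :=
  {x ∈ Ioc (0:ℝ) 1 |
    ∀ m ≥ N, L * ∑ i ∈ Finset.range m, (p2gleBranch (p2gleT^[i] x) - 1) ≤ (m : ℤ)}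

/-- The points whose first `m` branch indices are prescribed by a word `w` with average at most
`1 / L`. -/
def p2gleSparseCylinder (L m : ℕ) (w : Fin m → Fin (m + 1)) : Set ℝ :=
  {x ∈ Ioc (0:ℝ) 1 |
    (∀ i : Fin m, p2gleBranch (p2gleT^[i] x) = (w i : ℕ) + 1) ∧ L * ∑ i, (w i : ℕ) ≤ m}

lemma ediam_p2gleSparseCylinder_le (L m : ℕ) (w : Fin m → Fin (m + 1)) :
    Metric.ediam (p2gleSparseCylinder L m w) ≤ ENNReal.ofReal ((1 / 2) ^ m) := by
  refine Metric.ediam_le fun x hx y hy => ?_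
  rw [edist_dist, Real.dist_eq]
  refine ENNReal.ofReal_le_ofReal (abs_sub_le_of_p2gleBranch_eq hx.1 hy.1 fun i hi => ?_)
  rw [hx.2.1 ⟨i, hi⟩, hy.2.1 ⟨i, hi⟩]

lemma p2gleSparse_subset_iUnion_cylinder {L N m : ℕ} (hL : 1 ≤ L) (hm : N ≤ m) :
    p2gleSparse L N ⊆ ⋃ w, p2gleSparseCylinder L m w := by
  rintro x ⟨hx, hsum⟩
  have hsum := hsum m hm
  obtain ⟨c, hc⟩ : ∃ c : ℕ → ℕ, ∀ i, p2gleBranch (p2gleT^[i] x) = c i + 1 :=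
    ⟨fun i => (p2gleBranch (p2gleT^[i] x) - 1).toNat, fun i => by
      have := one_le_p2gleBranch (p2gleT_iterate_mem hx i)
      dsimp only
      omega⟩
  simp only [hc, add_sub_cancel_right] at hsum
  have hsum : L * ∑ i ∈ Finset.range m, c i ≤ m := by exact_mod_cast hsum
  have hlt (i : Fin m) : c i < m + 1 := by
    have h₁ : c i ≤ ∑ i ∈ Finset.range m, c i :=
      Finset.single_le_sum (f := c) (fun _ _ => Nat.zero_le _) (Finset.mem_range.2 i.2)
    have h₂ := Nat.le_mul_of_pos_left (∑ i ∈ Finset.range m, c i) hL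
    omega
  refine mem_iUnion.2 ⟨fun i => ⟨c i, hlt i⟩, hx, fun i => hc i, ?_⟩
  rwa [← Fin.sum_univ_eq_sum_range] at hsum

lemma ediam_p2gleSparseCylinder_rpow_le {s θ : ℝ} (hs : 0 < s) (hθ : 0 < θ) (hθ' : θ < 1)
    (L m : ℕ) (w : Fin m → Fin (m + 1)) :
    Metric.ediam (p2gleSparseCylinder L m w) ^ s ≤
      ENNReal.ofReal (((1 / 2) ^ s / θ) ^ m * ∏ i, (θ ^ L) ^ (w i : ℕ)) := by
  by_cases hw : L * ∑ i, (w i : ℕ) ≤ m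
  · refine (ENNReal.rpow_le_rpow (ediam_p2gleSparseCylinder_le L m w) hs.le).trans ?_
    rw [ENNReal.ofReal_rpow_of_pos (by positivity)]
    refine ENNReal.ofReal_le_ofReal ?_
    rw [Finset.prod_pow_eq_pow_sum, ← pow_mul, div_pow ((1 / 2 : ℝ) ^ s),
      Real.rpow_pow_comm (by norm_num), div_mul_eq_mul_div, le_div_iff₀ (by positivity)]
    exact mul_le_mul_of_nonneg_left (pow_le_pow_of_le_one hθ.le hθ'.le hw) (by positivity)
  · have : p2gleSparseCylinder L m w = ∅ := eq_empty_of_forall_notMem fun x hx => hw hx.2.2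
    rw [this, Metric.ediam_empty, ENNReal.zero_rpow_of_pos hs]
    exact zero_le

lemma sum_ediam_p2gleSparseCylinder_rpow_le {s θ : ℝ} (hs : 0 < s) (hθ : 0 < θ) (hθ' : θ < 1)
    {L : ℕ} (hL : 1 ≤ L) (m : ℕ) :
    ∑ w, Metric.ediam (p2gleSparseCylinder L m w) ^ s ≤
      ENNReal.ofReal (((1 / 2) ^ s / θ / (1 - θ ^ L)) ^ m) := by
  refine (Finset.sum_le_sum fun w _ => ediam_p2gleSparseCylinder_rpow_le hs hθ hθ' L m w).trans ?_
  rw [← ENNReal.ofReal_sum_of_nonneg fun _ _ => by positivity, ← Finset.mul_sum,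
    ← Fintype.sum_pow (fun a : Fin (m + 1) => (θ ^ L) ^ (a : ℕ)), ← mul_pow]
  refine ENNReal.ofReal_le_ofReal (pow_le_pow_left₀ (by positivity) ?_ m)
  have hθL : θ ^ L < 1 := pow_lt_one₀ hθ.le hθ' (by omega)
  rw [div_eq_mul_inv _ (1 - θ ^ L), Fin.sum_univ_eq_sum_range fun k => (θ ^ L) ^ k]
  refine mul_le_mul_of_nonneg_left ?_ (by positivity)
  rw [← tsum_geometric_of_lt_one (by positivity) hθL]
  exact (summable_geometric_of_lt_one (by positivity) hθL).sum_le_tsum _ fun _ _ => by positivity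

lemma exists_dimH_p2gleSparse_le {s : NNReal} (hs : 0 < s) :
    ∃ L : ℕ, 1 ≤ L ∧ ∀ N, dimH (p2gleSparse L N) ≤ s := by
  have hs' : (0:ℝ) < s := hs
  obtain ⟨θ, hrθ, hθ'⟩ : ∃ θ : ℝ, (1 / 2 : ℝ) ^ (s : ℝ) < θ ∧ θ < 1 :=
    exists_between (Real.rpow_lt_one (by norm_num) (by norm_num) hs')
  have hr : (0:ℝ) < (1 / 2 : ℝ) ^ (s : ℝ) := by positivity
  have hθ : 0 < θ := hr.trans hrθ
  have hq : 0 < 1 - (1 / 2 : ℝ) ^ (s : ℝ) / θ := sub_pos.2 ((div_lt_one hθ).2 hrθ)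
  obtain ⟨L, hL⟩ := exists_pow_lt_of_lt_one hq hθ'
  have hL1 : 1 ≤ L := by
    rcases Nat.eq_zero_or_pos L with rfl | h
    · have : 0 < (1 / 2 : ℝ) ^ (s : ℝ) / θ := by positivity
      rw [pow_zero] at hL
      linarith
    · exact h
  have hθL : θ ^ L < 1 := pow_lt_one₀ hθ.le hθ' (by omega)
  refine ⟨L, hL1, fun N => dimH_le_of_hausdorffMeasure_ne_top ?_⟩
  have hκ0 : 0 ≤ (1 / 2 : ℝ) ^ (s : ℝ) / θ / (1 - θ ^ L) :=
    div_nonneg (by positivity) (by linarith)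
  have hκ : (1 / 2 : ℝ) ^ (s : ℝ) / θ / (1 - θ ^ L) < 1 := by
    rw [div_lt_one] <;> linarith
  have hlim {κ : ℝ} (h0 : 0 ≤ κ) (h1 : κ < 1) :
      Tendsto (fun m : ℕ => ENNReal.ofReal (κ ^ m)) atTop (nhds 0) := by
    simpa using ENNReal.tendsto_ofReal (tendsto_pow_atTop_nhds_zero_of_lt_one h0 h1)
  have hle := Measure.hausdorffMeasure_le_liminf_sum (s : ℝ) (p2gleSparse L N) (l := atTop)
    _ (hlim (κ := 1 / 2) (by norm_num) (by norm_num)) (p2gleSparseCylinder L)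
    (.of_forall fun m w => ediam_p2gleSparseCylinder_le L m w)
    (eventually_atTop.2 ⟨N, fun m hm => p2gleSparse_subset_iUnion_cylinder hL1 hm⟩)
  have hzero := tendsto_of_tendsto_of_tendsto_of_le_of_le tendsto_const_nhds (hlim hκ0 hκ)
    (fun _ => zero_le) (sum_ediam_p2gleSparseCylinder_rpow_le hs' hθ hθ' hL1)
  rw [hzero.liminf_eq] at hle
  exact (hle.trans_lt ENNReal.zero_lt_top).ne

lemma sub_one_le_two_zpow_sub_two {n : ℤ} (hn : 1 ≤ n) : (n : ℝ) - 1 ≤ 2 ^ n - 2 := by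
  obtain ⟨k, rfl⟩ : ∃ k : ℕ, n = k + 1 := ⟨(n - 1).toNat, by omega⟩
  have := one_add_mul_le_pow (by norm_num : (-2:ℝ) ≤ 1) k
  rw [zpow_add_one₀ (by norm_num), zpow_natCast]
  push_cast
  norm_num at this
  linarith

lemma expDigitLevelSet_two_subset {L : ℕ} (hL : 1 ≤ L) :
    expDigitLevelSet 2 ⊆ p2gleExceptional ∪ ⋃ N, p2gleSparse L N := by
  rintro x ⟨hx, hlim⟩
  by_cases hxe : x ∈ p2gleExceptional
  · exact .inl hxe
  have hL0 : (0:ℝ) < L := by exact_mod_cast hL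
  have hev := hlim.eventually (gt_mem_nhds (by simpa using hL0 : (2:ℝ) < 2 + 1 / L))
  obtain ⟨N, hN⟩ := eventually_atTop.1 (hev.and (eventually_gt_atTop 0))
  refine .inr (mem_iUnion.2 ⟨N, hx, fun m hm => ?_⟩)
  obtain ⟨hlt, hm0⟩ := hN m hm
  rw [div_lt_iff₀ (by exact_mod_cast hm0)] at hlt
  have hsum : ∑ i ∈ Finset.range m, ((p2gleBranch (p2gleT^[i] x) : ℝ) - 1) ≤
      ∑ i ∈ Finset.range m, ((2:ℝ) ^ p2gleD i x - 2) := by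
    refine Finset.sum_le_sum fun i _ => ?_
    rw [p2gleD_eq_p2gleBranch hx hxe]
    exact sub_one_le_two_zpow_sub_two (one_le_p2gleBranch (p2gleT_iterate_mem hx i))
  rw [Finset.sum_sub_distrib _ (fun _ => (2:ℝ)), Finset.sum_const, Finset.card_range,
    nsmul_eq_mul] at hsum
  have : (L : ℝ) * ∑ i ∈ Finset.range m, ((p2gleBranch (p2gleT^[i] x) : ℝ) - 1) ≤ m := by
    calc _ ≤ (L : ℝ) * ((1 / L) * m) := by
          refine mul_le_mul_of_nonneg_left ?_ hL0.le
          linarith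
      _ = m := by field_simp
  exact_mod_cast this

lemma dimH_expDigitLevelSet_two : dimH (expDigitLevelSet 2) = 0 := by
  refine nonpos_iff_eq_zero.1 (ENNReal.le_of_forall_pos_le_add fun s hs _ => ?_)
  obtain ⟨L, hL, hdim⟩ := exists_dimH_p2gleSparse_le hs
  rw [zero_add]
  refine (dimH_mono (expDigitLevelSet_two_subset hL)).trans ?_
  rw [dimH_union, countable_p2gleExceptional.dimH_zero, dimH_iUnion]
  exact max_le zero_le (iSup_le hdim)

lemma p2gleBranch_preimage_inter_eq {k : ℤ} (hk : 1 ≤ k) (s : Set ℝ) :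
    p2gleBranch ⁻¹' {k} ∩ p2gleT ⁻¹' s ∩ Ioc 0 1 =
      ((2:ℝ) ^ k * ·) ⁻¹' ((· + (-1)) ⁻¹' (s ∩ Ioc 0 1)) := by
  have h2 : (2:ℝ) ≤ 2 ^ k := by
    simpa using zpow_le_zpow_right₀ (by norm_num : (1:ℝ) ≤ 2) hk
  ext x
  simp only [mem_inter_iff, mem_preimage, mem_singleton_iff]
  constructor
  · rintro ⟨⟨hb, hT⟩, hx⟩
    have hmem := p2gleT_mem hx.1
    rw [p2gleT_eq, hb, sub_eq_add_neg] at hT hmem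
    exact ⟨hT, hmem⟩
  · rintro ⟨hs, h₁, h₂⟩
    have hx0 : 0 < x := by
      by_contra! h
      nlinarith
    have hb : p2gleBranch x = k := by
      rw [p2gleBranch_eq_iff hx0]
      constructor <;> linarith
    refine ⟨⟨hb, ?_⟩, hx0, ?_⟩
    · rwa [p2gleT_eq, hb, sub_eq_add_neg]
    · nlinarith

lemma measurable_p2gleBranch : Measurable p2gleBranch := by
  unfold p2gleBranch
  exact (Int.measurable_floor.comp (by unfold Real.logb; fun_prop)).add_const 1

lemma measurable_p2gleT : Measurable p2gleT := by
  have h : Measurable fun k : ℤ => (2:ℝ) ^ k := measurable_from_top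
  exact ((h.comp measurable_p2gleBranch).mul measurable_id).sub_const 1

lemma volume_p2gleBranch_preimage_inter {k : ℤ} (hk : 1 ≤ k) {s : Set ℝ} (hs : MeasurableSet s) :
    volume.restrict (Ioc (0:ℝ) 1) (p2gleBranch ⁻¹' {k} ∩ p2gleT ⁻¹' s) =
      ENNReal.ofReal (2 ^ (-k)) * volume.restrict (Ioc (0:ℝ) 1) s := by
  rw [Measure.restrict_apply ((measurable_p2gleBranch (measurableSet_singleton k)).inter
      (measurable_p2gleT hs)), p2gleBranch_preimage_inter_eq hk,
    Real.volume_preimage_mul_left (by positivity), measure_preimage_add_right,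
    Measure.restrict_apply hs, abs_of_pos (by positivity), zpow_neg]

lemma volume_p2gleBranch_preimage_singleton {k : ℤ} (hk : 1 ≤ k) :
    volume.restrict (Ioc (0:ℝ) 1) (p2gleBranch ⁻¹' {k}) = ENNReal.ofReal (2 ^ (-k)) := by
  simpa using volume_p2gleBranch_preimage_inter hk MeasurableSet.univ

lemma volume_p2gleBranch_preimage_singleton_inter (k : ℤ) {s : Set ℝ} (hs : MeasurableSet s) :
    volume.restrict (Ioc (0:ℝ) 1) (p2gleBranch ⁻¹' {k} ∩ p2gleT ⁻¹' s) =
      volume.restrict (Ioc (0:ℝ) 1) (p2gleBranch ⁻¹' {k}) *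
        volume.restrict (Ioc (0:ℝ) 1) s := by
  by_cases hk : 1 ≤ k
  · rw [volume_p2gleBranch_preimage_inter hk hs, volume_p2gleBranch_preimage_singleton hk]
  · have h0 : volume.restrict (Ioc (0:ℝ) 1) (p2gleBranch ⁻¹' {k}) = 0 := by
      rw [Measure.restrict_apply (measurable_p2gleBranch (measurableSet_singleton k))]
      refine (congrArg volume (eq_empty_of_forall_notMem fun x hx => ?_)).trans measure_empty
      exact hk (hx.1 ▸ one_le_p2gleBranch hx.2)
    rw [h0, zero_mul]
    exact measure_mono_null inter_subset_left h0

lemma volume_p2gleBranch_preimage_inter_eq_mul (t : Set ℤ) {s : Set ℝ} (hs : MeasurableSet s) :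
    volume.restrict (Ioc (0:ℝ) 1) (p2gleBranch ⁻¹' t ∩ p2gleT ⁻¹' s) =
      volume.restrict (Ioc (0:ℝ) 1) (p2gleBranch ⁻¹' t) *
        volume.restrict (Ioc (0:ℝ) 1) s := by
  have hm (t : Set ℤ) : MeasurableSet (p2gleBranch ⁻¹' t) := measurable_p2gleBranch trivial
  rw [← Measure.restrict_apply (hm t),
    ← tsum_measure_preimage_singleton t.to_countable fun y _ => hm {y},
    ← tsum_measure_preimage_singleton t.to_countable fun y _ => hm {y}, ← ENNReal.tsum_mul_right]
  refine tsum_congr fun k => ?_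
  rw [Measure.restrict_apply (hm _), volume_p2gleBranch_preimage_singleton_inter _ hs]

lemma measurePreserving_p2gleT :
    MeasurePreserving p2gleT (volume.restrict (Ioc (0:ℝ) 1)) (volume.restrict (Ioc (0:ℝ) 1)) := by
  refine ⟨measurable_p2gleT, Measure.ext fun s hs => ?_⟩
  rw [Measure.map_apply measurable_p2gleT hs]
  simpa using volume_p2gleBranch_preimage_inter_eq_mul univ hs

lemma indepFun_p2gleBranch_p2gleT :
    ProbabilityTheory.IndepFun p2gleBranch p2gleT (volume.restrict (Ioc (0:ℝ) 1)) := by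
  rw [ProbabilityTheory.indepFun_iff_measure_inter_preimage_eq_mul]
  intro t s _ hs
  rw [volume_p2gleBranch_preimage_inter_eq_mul t hs,
    measurePreserving_p2gleT.measure_preimage hs.nullMeasurableSet]

lemma indepFun_p2gleBranch_iterate {i j : ℕ} (hij : i < j) :
    ProbabilityTheory.IndepFun (fun x => p2gleBranch (p2gleT^[i] x))
      (fun x => p2gleBranch (p2gleT^[j] x)) (volume.restrict (Ioc (0:ℝ) 1)) := by
  obtain ⟨l, rfl⟩ := Nat.exists_eq_add_of_lt hij
  have hmp := measurePreserving_p2gleT.iterate i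
  have hind : ProbabilityTheory.IndepFun p2gleBranch (fun x => p2gleBranch (p2gleT^[l] (p2gleT x)))
      (volume.restrict (Ioc (0:ℝ) 1)) :=
    indepFun_p2gleBranch_p2gleT.comp measurable_id
      (measurable_p2gleBranch.comp (measurable_p2gleT.iterate l))
  rw [ProbabilityTheory.indepFun_iff_measure_inter_preimage_eq_mul] at hind ⊢
  intro s t hs ht
  have hs' : MeasurableSet (p2gleBranch ⁻¹' s) := measurable_p2gleBranch hs
  have ht' : MeasurableSet ((fun x => p2gleBranch (p2gleT^[l] (p2gleT x))) ⁻¹' t) :=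
    (measurable_p2gleBranch.comp ((measurable_p2gleT.iterate l).comp measurable_p2gleT)) ht
  have h₁ : (fun x => p2gleBranch (p2gleT^[i] x)) ⁻¹' s = p2gleT^[i] ⁻¹' (p2gleBranch ⁻¹' s) := rfl
  have h₂ : (fun x => p2gleBranch (p2gleT^[i + l + 1] x)) ⁻¹' t =
      p2gleT^[i] ⁻¹' ((fun x => p2gleBranch (p2gleT^[l] (p2gleT x))) ⁻¹' t) := by
    ext x
    rw [mem_preimage, mem_preimage, mem_preimage, ← Function.iterate_succ_apply,
      ← Function.iterate_add_apply, show l.succ + i = i + l + 1 by omega]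
  rw [h₁, h₂, ← preimage_inter, hmp.measure_preimage (hs'.inter ht').nullMeasurableSet,
    hmp.measure_preimage hs'.nullMeasurableSet, hmp.measure_preimage ht'.nullMeasurableSet]
  exact hind s t hs ht

/-- The function `n ↦ 2 ^ n` truncated to `1 ≤ n ≤ M`. -/
noncomputable def truncExp (M : ℕ) (n : ℤ) : ℝ :=
  ∑ k ∈ Finset.range M, ({(k : ℤ) + 1} : Set ℤ).indicator (fun _ => (2:ℝ) ^ ((k : ℤ) + 1)) n

lemma truncExp_le (M : ℕ) (n : ℤ) : truncExp M n ≤ 2 ^ n := by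
  by_cases h : ∃ k ∈ Finset.range M, n = (k : ℤ) + 1
  · obtain ⟨k, hk, rfl⟩ := h
    rw [truncExp, Finset.sum_eq_single_of_mem k hk fun l _ hl => indicator_of_notMem (by
      simpa using hl.symm) _, indicator_of_mem (mem_singleton _)]
  · push Not at h
    rw [truncExp, Finset.sum_eq_zero fun k hk => indicator_of_notMem (by simpa using h k hk) _]
    positivity

lemma truncExp_p2gleBranch (M : ℕ) (x : ℝ) :
    truncExp M (p2gleBranch x) = ∑ k ∈ Finset.range M,
      (p2gleBranch ⁻¹' {(k : ℤ) + 1}).indicator (fun _ => (2:ℝ) ^ ((k : ℤ) + 1)) x := rfl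

lemma integrable_indicator_p2gleBranch (k : ℕ) :
    Integrable ((p2gleBranch ⁻¹' {(k : ℤ) + 1}).indicator (fun _ => (2:ℝ) ^ ((k : ℤ) + 1)))
      (volume.restrict (Ioc (0:ℝ) 1)) :=
  (integrable_const _).indicator (measurable_p2gleBranch (measurableSet_singleton _))

lemma integrable_truncExp (M : ℕ) :
    Integrable (fun x => truncExp M (p2gleBranch x)) (volume.restrict (Ioc (0:ℝ) 1)) :=
  integrable_finsetSum _ fun k _ => integrable_indicator_p2gleBranch k

lemma integral_truncExp (M : ℕ) :
    ∫ x, truncExp M (p2gleBranch x) ∂(volume.restrict (Ioc (0:ℝ) 1)) = M := by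
  simp only [truncExp_p2gleBranch]
  rw [integral_finsetSum _ fun k _ => integrable_indicator_p2gleBranch k]
  have h (k : ℕ) : ∫ x, (p2gleBranch ⁻¹' {(k : ℤ) + 1}).indicator
      (fun _ => (2:ℝ) ^ ((k : ℤ) + 1)) x ∂(volume.restrict (Ioc (0:ℝ) 1)) = 1 := by
    rw [integral_indicator_const _ (measurable_p2gleBranch (measurableSet_singleton _)),
      measureReal_def, volume_p2gleBranch_preimage_singleton (by omega),
      ENNReal.toReal_ofReal (by positivity), smul_eq_mul, ← zpow_add₀ (by norm_num)]
    norm_num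
  simp [h]

lemma ae_tendsto_average_truncExp (M : ℕ) :
    ∀ᵐ x ∂(volume.restrict (Ioc (0:ℝ) 1)),
      Tendsto (fun m : ℕ => (∑ j ∈ Finset.range m, truncExp M (p2gleBranch (p2gleT^[j] x))) / m)
        atTop (nhds M) := by
  have hmeas : Measurable (truncExp M) := measurable_from_top
  have := ProbabilityTheory.strong_law_ae_real (μ := volume.restrict (Ioc (0:ℝ) 1))
    (fun j x => truncExp M (p2gleBranch (p2gleT^[j] x))) (integrable_truncExp M)
    (fun i j hij => by
      rcases hij.lt_or_gt with h | h
      · exact (indepFun_p2gleBranch_iterate h).comp hmeas hmeas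
      · exact ((indepFun_p2gleBranch_iterate h).comp hmeas hmeas).symm)
    (fun i => by
      have hmp := measurePreserving_p2gleT.iterate i
      have hm : Measurable fun x => truncExp M (p2gleBranch x) := hmeas.comp measurable_p2gleBranch
      refine ⟨(hm.comp hmp.measurable).aemeasurable, hm.aemeasurable, ?_⟩
      change Measure.map ((fun x => truncExp M (p2gleBranch x)) ∘ p2gleT^[i]) _ =
        Measure.map (fun x => truncExp M (p2gleBranch x)) _
      rw [← Measure.map_map hm hmp.measurable, hmp.map_eq])
  simpa only [Function.iterate_zero, id, integral_truncExp] using this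

lemma ae_mem_expDigitInfSet :
    ∀ᵐ x ∂(volume.restrict (Ioc (0:ℝ) 1)), x ∈ expDigitInfSet := by
  have hexc : ∀ᵐ x ∂(volume.restrict (Ioc (0:ℝ) 1)), x ∉ p2gleExceptional :=
    measure_eq_zero_iff_ae_notMem.1 (countable_p2gleExceptional.measure_zero _)
  filter_upwards [ae_restrict_mem measurableSet_Ioc, hexc,
    ae_all_iff.2 ae_tendsto_average_truncExp] with x hx hxe hlim
  refine ⟨hx, tendsto_atTop.2 fun b => ?_⟩
  obtain ⟨M, hM⟩ := exists_nat_gt b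
  filter_upwards [(hlim M).eventually (lt_mem_nhds hM)] with m hm
  refine hm.le.trans (div_le_div_of_nonneg_right (Finset.sum_le_sum fun j _ => ?_) (by positivity))
  rw [p2gleD_eq_p2gleBranch hx hxe]
  exact truncExp_le _ _

lemma dimH_expDigitInfSet : dimH expDigitInfSet = 1 := by
  refine le_antisymm ((dimH_mono (subset_univ _)).trans_eq Real.dimH_univ) ?_
  by_contra! h
  have h0 := hausdorffMeasure_of_dimH_lt (d := 1) (by simpa using h)
  rw [NNReal.coe_one, hausdorffMeasure_real] at h0
  have h1 : ∀ᵐ x ∂(volume.restrict (Ioc (0:ℝ) 1)), x ∉ expDigitInfSet :=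
    ae_restrict_of_ae (measure_eq_zero_iff_ae_notMem.1 h0)
  have h2 : ∀ᵐ x ∂(volume.restrict (Ioc (0:ℝ) 1)), False := by
    filter_upwards [h1, ae_mem_expDigitInfSet] with x hx hx' using hx hx'
  rw [eventually_false_iff_eq_bot, ae_eq_bot, Measure.restrict_eq_zero] at h2
  simp at h2

theorem dimH_exp_digit_boundary :
    dimH (expDigitLevelSet 2) = 0 ∧ dimH expDigitInfSet = 1 := by
  exact ⟨dimH_expDigitLevelSet_two, dimH_expDigitInfSet⟩
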